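/- Let R be a von Neumann regular ring, N a nonzero right ideal of R, and X a set of idempotents in N such that the sum Σ_{e∈X} eR is direct (independent). Then there exists a set of idempotents X' ⊆ N containing X such that Σ_{e∈X'} eR is direct and essential in N. -/

import Mathlib

/-- The cyclic right ideal `aR`, as a submodule of `R` over `Rᵐᵒᵖ`. -/
def rspan (R : Type*) [Ring R] (a : R) : Submodule Rᵐᵒᵖ R := Submodule.span Rᵐᵒᵖ {a}

theorem indep_iff_aux {R : Type*} [Ring R] (Y : Set R) :
    iSupIndep (fun e : Y => rspan R (e : R)) ↔
      ∀ s : Finset R, (s : Set R) ⊆ Y → s.SupIndep (rspan R) := by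
  classical
  rw [iSupIndep_iff_supIndep]
  constructor
  · intro h s hs
    have h1 := h (s.subtype (· ∈ Y))
    have h2 := (Finset.supIndep_map (s := s.subtype (· ∈ Y))
      (g := Function.Embedding.subtype (· ∈ Y)) (f := rspan R)).2 h1
    rwa [Finset.subtype_map_of_mem (fun x hx => hs hx)] at h2
  · intro h s
    have h2 := h (s.map (Function.Embedding.subtype (· ∈ Y))) (by
      intro x hx
      simp at hx
      exact hx.1)
    exact (Finset.supIndep_map (s := s)
      (g := Function.Embedding.subtype (· ∈ Y)) (f := rspan R)).1 h2

/-- In a von Neumann regular ring `R`, if `N` is a nonzero right ideal and `X` a set of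
idempotents in `N` whose cyclic right ideals form an independent family, then `X` extends
to a set of idempotents `X' ⊆ N` with `Σ_{e∈X'} eR` direct and essential in `N`. -/
theorem exists_independent_essential_idempotents {R : Type*} [Ring R]
    (hreg : ∀ x : R, ∃ y : R, x * y * x = x)
    (N : Submodule Rᵐᵒᵖ R) (hN : N ≠ ⊥)
    (X : Set R) (hXidem : ∀ e ∈ X, IsIdempotentElem e) (hXN : ∀ e ∈ X, e ∈ N)
    (hind : iSupIndep (fun e : X => rspan R (e : R))) :
    ∃ X' : Set R, X ⊆ X' ∧ (∀ e ∈ X', IsIdempotentElem e) ∧ (∀ e ∈ X', e ∈ N) ∧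
      iSupIndep (fun e : X' => rspan R (e : R)) ∧
      (⨆ e : X', rspan R (e : R)) ≤ N ∧
      (∀ L : Submodule Rᵐᵒᵖ R, L ≤ N → L ≠ ⊥ →
        (⨆ e : X', rspan R (e : R)) ⊓ L ≠ ⊥) := by
  classical
  obtain ⟨Y, hXY, hmax⟩ := zorn_subset_nonempty
    {Y : Set R | (∀ e ∈ Y, IsIdempotentElem e) ∧ (∀ e ∈ Y, e ∈ N) ∧
      iSupIndep (fun e : Y => rspan R (e : R))} (by
    intro c hc hchain hne
    refine ⟨⋃₀ c, ⟨?_, ?_, ?_⟩, fun s hs => Set.subset_sUnion_of_mem hs⟩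
    · rintro e ⟨s, hs, he⟩
      exact (hc hs).1 e he
    · rintro e ⟨s, hs, he⟩
      exact (hc hs).2.1 e he
    · rw [indep_iff_aux]
      intro s hs
      obtain ⟨t, ht, hst⟩ := hchain.directedOn.exists_mem_subset_of_finite_of_subset_sUnion
        hne s.finite_toSet hs
      exact (indep_iff_aux t).1 (hc ht).2.2 s hst) X ⟨hXidem, hXN, hind⟩
  obtain ⟨hYi, hYN, hYind⟩ := hmax.prop
  refine ⟨Y, hXY, hYi, hYN, hYind, ?_, ?_⟩
  · refine iSup_le fun e => ?_
    rw [rspan, Submodule.span_singleton_le_iff_mem]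
    exact hYN e e.2
  · intro L hLN hL hbot
    obtain ⟨x, hxL, hx0⟩ := Submodule.exists_mem_ne_zero_of_ne_bot hL
    obtain ⟨y, hy⟩ := hreg x
    have hgL : x * y ∈ L := L.smul_mem (MulOpposite.op y) hxL
    have hg0 : x * y ≠ 0 := by
      intro h
      rw [h, zero_mul] at hy
      exact hx0 hy.symm
    have hgi : IsIdempotentElem (x * y) := by
      rw [IsIdempotentElem, ← mul_assoc, hy]
    have hgle : rspan R (x * y) ≤ L := by
      rw [rspan, Submodule.span_singleton_le_iff_mem]
      exact hgL
    have hmem : x * y ∈ rspan R (x * y) := Submodule.mem_span_singleton_self _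
    have hdis : Disjoint (rspan R (x * y)) (⨆ e : Y, rspan R (e : R)) :=
      ((disjoint_iff.2 hbot).mono_right hgle).symm
    have hins : insert (x * y) Y ⊆ Y := by
      refine hmax.le_of_ge ⟨?_, ?_, ?_⟩ (Set.subset_insert _ _)
      · rintro e (rfl | he)
        · exact hgi
        · exact hYi e he
      · rintro e (rfl | he)
        · exact hLN hgL
        · exact hYN e he
      · rw [indep_iff_aux]
        intro s hs
        have hsub : ((s.erase (x * y) : Finset R) : Set R) ⊆ Y := by
          intro z hz
          rw [Finset.mem_coe, Finset.mem_erase] at hz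
          exact (hs hz.2).resolve_left hz.1
        have h1 := (indep_iff_aux Y).1 hYind _ hsub
        refine (h1.insert (i := x * y) (hdis.mono_right ?_)).subset
          (Finset.insert_erase_subset _ _)
        exact Finset.sup_le fun z hz => le_iSup (fun e : Y => rspan R (e : R)) ⟨z, hsub hz⟩
    have hgY : x * y ∈ Y := hins (Set.mem_insert _ _)
    have hle := le_iSup (fun e : Y => rspan R (e : R)) ⟨x * y, hgY⟩
    exact hg0 (Submodule.disjoint_def.1 hdis _ hmem (hle hmem))
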